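/- Let k ≥ 2 and let q be a prime power. The bipartite incidence graph G_arc(k,q,α_0^-) is isomorphic to Wenger's graph H(k,q). Here G_arc(k,q,α_0^-) is the bipartite graph whose first part P is the set of points of the projective space PG(k,q) (i.e., one-dimensional linear subspaces of F_q^{k+1}) not contained in the hyperplane Σ_0 = {x : x_0 = 0}, whose second part L is the set of projective lines of PG(k,q) (i.e., two-dimensional linear subspaces of F_q^{k+1}) whose intersection with Σ_0 is a point of α_0^- = { [0 : 1 : x : x^2 : ⋯ : x^{k−1}] : x ∈ F_q }, and where p ∈ P is adjacent to ℓ ∈ L if and only if p ⊆ ℓ. -/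

import Mathlib

open scoped Classical

namespace Paper

/-- `G` contains a copy of `F` (an injective graph homomorphism of `F` into `G`). -/
def HasGraphCopy {α β : Type*} (F : SimpleGraph α) (G : SimpleGraph β) : Prop :=
  ∃ f : α ↪ β, ∀ u v, F.Adj u v → G.Adj (f u) (f v)

/-- The 3-uniform hypergraph `H` contains a copy of the 3-uniform hypergraph `F`. -/
def HasHypCopy {α β : Type*} (F : Set (Finset α)) (H : Set (Finset β)) : Prop :=
  ∃ f : α ↪ β, ∀ e ∈ F, e.map f ∈ H

/-- The suspension `Ĝ` of a graph `G`: a new vertex (`none`) joined to all vertices of `G`. -/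
def suspension {α : Type*} (G : SimpleGraph α) : SimpleGraph (Option α) :=
  SimpleGraph.fromRel (fun x y => x = none ∨ ∃ u v, x = some u ∧ y = some v ∧ G.Adj u v)

/-- The hypergraph suspension `G̃` of a graph `G`: the triples `{x, u, v}` over edges `uv` of `G`,
where `x = none` is a new vertex. -/
def hypSuspension {α : Type*} (G : SimpleGraph α) : Set (Finset (Option α)) :=
  {e | ∃ u v, G.Adj u v ∧ e = {none, some u, some v}}

/-- `ex(n, K₃, F)`: the maximum number of triangles in an `F`-free graph on `n` vertices. -/
noncomputable def exTriangles {α : Type*} (n : ℕ) (F : SimpleGraph α) : ℕ :=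
  sSup {t | ∃ G : SimpleGraph (Fin n),
    ¬ HasGraphCopy F G ∧ t = {s : Finset (Fin n) | G.IsNClique 3 s}.ncard}

/-- `ex₃(n, F)`: the maximum number of triples in an `F`-free 3-uniform hypergraph on `n`
vertices. -/
noncomputable def ex3 {α : Type*} (n : ℕ) (F : Set (Finset α)) : ℕ :=
  sSup {t | ∃ H : Finset (Finset (Fin n)), (∀ e ∈ H, e.card = 3) ∧
    ¬ HasHypCopy F (↑H : Set (Finset (Fin n))) ∧ t = H.card}

/-- `ex(n, C_m)`: the maximum number of edges in a graph on `n` vertices with no cycle of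
length `m`. -/
noncomputable def exCycle (n m : ℕ) : ℕ :=
  sSup {t | ∃ G : SimpleGraph (Fin n),
    ¬ HasGraphCopy (SimpleGraph.cycleGraph m) G ∧ t = G.edgeSet.ncard}

/-- The link of a vertex `x` in a 3-uniform hypergraph `H`: `u ~ v` iff `{x, u, v} ∈ H`. -/
def linkGraph {V : Type*} (H : Set (Finset V)) (x : V) : SimpleGraph V :=
  SimpleGraph.fromRel (fun u v => u ≠ x ∧ v ≠ x ∧ ({x, u, v} : Finset V) ∈ H)

/-!  Coordinates of a vector are labelled `x_1, x_{11}, x_{12}, x_{21}, x_{22}, x'_{22}, x_{23},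
x_{32}, x_{33}, x'_{33}, x_{34}, x_{43}, …` and indexed `0, 1, 2, …`.  The `j`-th defining
equation (`j ≥ 1`) of the graph `D(q)` has the form `a_j + b_j + a_{aIdx j} * b_{bIdx j} = 0`. -/

/-- Index of the `a`-coordinate in the product term of the `j`-th equation. -/
def aIdx : ℕ → ℕ
  | 1 => 0
  | 2 => 0
  | 3 => 1
  | j => if j % 4 = 0 ∨ j % 4 = 3 then j - 2 else 0

/-- Index of the `b`-coordinate in the product term of the `j`-th equation. -/
def bIdx : ℕ → ℕ
  | 1 => 0
  | 2 => 1
  | 3 => 0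
  | j => if j % 4 = 0 ∨ j % 4 = 3 then 0 else j - 2

/-- Index of the extra linear term in the `j`-th equation of `D'(q)` (for `j ≥ 2`). -/
def linIdx : ℕ → ℕ
  | 2 => 1
  | j => j - 2

/-- Extend a vector in `F^k` to an `ℕ`-indexed sequence by zeros. -/
def ext {k : ℕ} {F : Type*} [Zero F] (a : Fin k → F) (j : ℕ) : F :=
  if h : j < k then a ⟨j, h⟩ else 0

/-- The defining relation of the 3-graph `D₃(k,q)`: the first `k-1` equations. -/
def D3rel (k : ℕ) (F : Type*) [CommRing F] (a b c : Fin k → F) : Prop :=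
  ∀ j : ℕ, 1 ≤ j → j < k →
    ext a j + ext b j + ext c j
      + ext a (aIdx j) * ext b (bIdx j)
      + ext b (aIdx j) * ext c (bIdx j)
      + ext c (aIdx j) * ext a (bIdx j) = 0

/-- The defining relation of the bipartite graph `D(k,q)`: the first `k-1` equations. -/
def Drel (k : ℕ) (F : Type*) [CommRing F] (a b : Fin k → F) : Prop :=
  ∀ j : ℕ, 1 ≤ j → j < k →
    ext a j + ext b j + ext a (aIdx j) * ext b (bIdx j) = 0

/-- The defining relation of the bipartite graph `D'(k,q)`: the first `k-1` equations. -/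
def D'rel (k : ℕ) (F : Type*) [CommRing F] (a b : Fin k → F) : Prop :=
  ∀ j : ℕ, 1 ≤ j → j < k →
    if j = 1 then
      ext a 1 - ext a 0 + ext b 1 - ext b 0 + ext a 0 * ext b 0 = 0
    else
      ext a j + ext a (linIdx j) + ext b j + ext b (linIdx j)
        + ext a (aIdx j) * ext b (bIdx j) = 0

/-- The bipartite graph `D(k,q)` on two copies of `F^k`. -/
def DGraph (k : ℕ) (F : Type*) [CommRing F] :
    SimpleGraph ((Fin k → F) ⊕ (Fin k → F)) :=
  SimpleGraph.fromRel (fun x y => ∃ a b, x = Sum.inl a ∧ y = Sum.inr b ∧ Drel k F a b)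

/-- The bipartite graph `D'(k,q)` on two copies of `F^k`. -/
def D'Graph (k : ℕ) (F : Type*) [CommRing F] :
    SimpleGraph ((Fin k → F) ⊕ (Fin k → F)) :=
  SimpleGraph.fromRel (fun x y => ∃ a b, x = Sum.inl a ∧ y = Sum.inr b ∧ D'rel k F a b)

/-- `{a,b,c}`-membership for the link of a vertex `v` lying in part `p` of `D₃(k,q)`:
for `p = 0` (part `A`) the two remaining parts are `B, C`; for `p = 1` (part `B`) they are
`C, A`; for `p = 2` (part `C`) they are `A, B`. -/
def D3edgeProp (k : ℕ) (F : Type*) [CommRing F] (p : Fin 3) (v u w : Fin k → F) : Prop :=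
  if p = 0 then D3rel k F v u w
  else if p = 1 then D3rel k F w v u
  else D3rel k F u w v

/-- The link of the vertex `v` in part `p` of the 3-partite 3-graph `D₃(k,q)`, as a bipartite
graph on the two remaining parts. -/
def linkD3 (k : ℕ) (F : Type*) [CommRing F] (p : Fin 3) (v : Fin k → F) :
    SimpleGraph ((Fin k → F) ⊕ (Fin k → F)) :=
  SimpleGraph.fromRel
    (fun x y => ∃ u w, x = Sum.inl u ∧ y = Sum.inr w ∧ D3edgeProp k F p v u w)


/-- The hyperplane `Σ₀ = {x : x₀ = 0}` of `F^{k+1}`. -/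
def Sigma0 (k : ℕ) (F : Type*) [Field F] : Submodule F (Fin (k + 1) → F) :=
  LinearMap.ker (LinearMap.proj (0 : Fin (k + 1)))

/-- The vector `(0, 1, x, x², …, x^{k-1})` spanning a point of the normal rational curve
`α₀⁻` inside `Σ₀`. -/
def nrc (k : ℕ) (F : Type*) [Field F] (x : F) : Fin (k + 1) → F :=
  fun i => if (i : ℕ) = 0 then 0 else x ^ ((i : ℕ) - 1)

/-- The points of `PG(k,q)` not contained in `Σ₀`. -/
def ArcPoint (k : ℕ) (F : Type*) [Field F] :=
  {p : Submodule F (Fin (k + 1) → F) // Module.finrank F p = 1 ∧ ¬ p ≤ Sigma0 k F}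

/-- The lines of `PG(k,q)` meeting `Σ₀` in a point of `α₀⁻`. -/
def ArcLine (k : ℕ) (F : Type*) [Field F] :=
  {l : Submodule F (Fin (k + 1) → F) //
    Module.finrank F l = 2 ∧ ∃ x : F, l ⊓ Sigma0 k F = Submodule.span F {nrc k F x}}

/-- The bipartite point-line incidence graph `G_arc(k, q, α₀⁻)`. -/
def GArc (k : ℕ) (F : Type*) [Field F] : SimpleGraph (ArcPoint k F ⊕ ArcLine k F) :=
  SimpleGraph.fromRel
    (fun u w => ∃ (p : ArcPoint k F) (l : ArcLine k F),
      u = Sum.inl p ∧ w = Sum.inr l ∧ p.1 ≤ l.1)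

/-- The defining relation of Wenger's graph `H(k,q)`:
`a_i + b_i = a₁ b₁^{i-1}` for `2 ≤ i ≤ k` (indices shifted down by one). -/
def Wrel (k : ℕ) (F : Type*) [CommRing F] (a b : Fin k → F) : Prop :=
  ∀ j : ℕ, 1 ≤ j → j < k → ext a j + ext b j = ext a 0 * ext b 0 ^ j

/-- Wenger's bipartite graph `H(k,q)` on two copies of `F^k`. -/
def WGraph (k : ℕ) (F : Type*) [CommRing F] :
    SimpleGraph ((Fin k → F) ⊕ (Fin k → F)) :=
  SimpleGraph.fromRel (fun x y => ∃ a b, x = Sum.inl a ∧ y = Sum.inr b ∧ Wrel k F a b)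

section Coordinates

variable {k : ℕ} {F : Type*} [Field F]

/-- The affine point `(1, a₁, …, a_k)` as a vector of `F^{k+1}`. -/
def affineVec (a : Fin k → F) : Fin (k + 1) → F := Fin.cons 1 a

/-- The affine vector `(1, 0, -b₂, …, -b_k)`, through which the line with label `b` passes. -/
def baseVec (b : Fin k → F) : Fin (k + 1) → F :=
  Fin.cons 1 (fun j => if (j : ℕ) = 0 then 0 else -b j)

/-- The projective line through `baseVec b` with direction `nrc k F (b₁)`. -/
def lineSpan (b : Fin k → F) : Submodule F (Fin (k + 1) → F) :=
  Submodule.span F {baseVec b, nrc k F (ext b 0)}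

@[simp] lemma affineVec_zero (a : Fin k → F) : affineVec a 0 = 1 := rfl

@[simp] lemma affineVec_succ (a : Fin k → F) (j : Fin k) : affineVec a j.succ = a j := rfl

@[simp] lemma baseVec_zero (b : Fin k → F) : baseVec b 0 = 1 := rfl

@[simp] lemma baseVec_succ (b : Fin k → F) (j : Fin k) :
    baseVec b j.succ = if (j : ℕ) = 0 then 0 else -b j := rfl

@[simp] lemma nrc_zero (x : F) : nrc k F x 0 = 0 := by simp [nrc]

@[simp] lemma nrc_succ (x : F) (j : Fin k) : nrc k F x j.succ = x ^ (j : ℕ) := by simp [nrc]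

lemma mem_Sigma0 {v : Fin (k + 1) → F} : v ∈ Sigma0 k F ↔ v 0 = 0 := by
  simp [Sigma0]

lemma ext_of_lt (a : Fin k → F) {j : ℕ} (h : j < k) : ext a j = a ⟨j, h⟩ := by
  simp [ext, h]

lemma nrc_ne_zero (hk : 0 < k) (x : F) : nrc k F x ≠ 0 := fun h => by
  simpa [-Fin.succ_mk] using congrFun h (Fin.succ ⟨0, hk⟩)

lemma mem_lineSpan {b : Fin k → F} {v : Fin (k + 1) → F} :
    v ∈ lineSpan b ↔ ∃ t : F, v 0 • baseVec b + t • nrc k F (ext b 0) = v := by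
  rw [lineSpan, Submodule.mem_span_pair]
  constructor
  · rintro ⟨s, t, rfl⟩
    exact ⟨t, by simp⟩
  · rintro ⟨t, h⟩
    exact ⟨_, t, h⟩

lemma affineVec_mem_lineSpan (hk : 0 < k) (a b : Fin k → F) :
    affineVec a ∈ lineSpan b ↔ Wrel k F a b := by
  rw [mem_lineSpan]
  constructor
  · rintro ⟨t, h⟩ j hj hjk
    have h0 := congrFun h (Fin.succ ⟨0, hk⟩)
    have h1 := congrFun h (Fin.succ ⟨j, hjk⟩)
    have hj0 : j ≠ 0 := by omega
    simp [hj0, -Fin.succ_mk] at h0 h1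
    rw [ext_of_lt a hjk, ext_of_lt b hjk, ext_of_lt a hk, ← h0, ← h1]
    ring
  · intro h
    refine ⟨ext a 0, funext fun i => ?_⟩
    refine Fin.cases (by simp) (fun j => ?_) i
    by_cases hj : (j : ℕ) = 0
    · obtain rfl : j = ⟨0, hk⟩ := Fin.ext hj
      simp [ext_of_lt a hk, -Fin.succ_mk]
    · have := h j (by omega) j.2
      rw [ext_of_lt a j.2, ext_of_lt b j.2] at this
      simp only [Pi.add_apply, Pi.smul_apply, smul_eq_mul, affineVec_zero, affineVec_succ,
        baseVec_succ, nrc_succ, if_neg hj, ← this]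
      ring

lemma lineSpan_inf_Sigma0 (b : Fin k → F) :
    lineSpan b ⊓ Sigma0 k F = Submodule.span F {nrc k F (ext b 0)} := by
  ext v
  rw [Submodule.mem_inf, mem_lineSpan, mem_Sigma0, Submodule.mem_span_singleton]
  constructor
  · rintro ⟨⟨t, h⟩, h0⟩
    exact ⟨t, by simpa [h0] using h⟩
  · rintro ⟨t, rfl⟩
    exact ⟨⟨t, by simp⟩, by simp⟩

lemma finrank_lineSpan (hk : 0 < k) (b : Fin k → F) : Module.finrank F (lineSpan b) = 2 := by
  have hli : LinearIndependent F ![baseVec b, nrc k F (ext b 0)] := by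
    rw [LinearIndependent.pair_iff]
    intro s t h
    have hs : s = 0 := by simpa using congrFun h 0
    subst hs
    exact ⟨rfl, by simpa [-Fin.succ_mk] using congrFun h (Fin.succ ⟨0, hk⟩)⟩
  rw [lineSpan, ← Matrix.range_cons_cons_empty _ _ ![], finrank_span_eq_card hli,
    Fintype.card_fin]

lemma lineSpan_injective (hk : 2 ≤ k) :
    Function.Injective (lineSpan : (Fin k → F) → Submodule F (Fin (k + 1) → F)) := by
  intro b b' h
  have hk0 : 0 < k := by omega
  have h0 : ext b 0 = ext b' 0 := by
    have hmem : nrc k F (ext b 0) ∈ Submodule.span F {nrc k F (ext b' 0)} := by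
      rw [← lineSpan_inf_Sigma0, ← h, lineSpan_inf_Sigma0]
      exact Submodule.mem_span_singleton_self _
    obtain ⟨t, ht⟩ := Submodule.mem_span_singleton.mp hmem
    have ht0 : t = 1 := by simpa [-Fin.succ_mk] using congrFun ht (Fin.succ ⟨0, hk0⟩)
    simpa [ht0, -Fin.succ_mk] using (congrFun ht (Fin.succ ⟨1, by omega⟩)).symm
  have hmem : baseVec b ∈ lineSpan b' := h ▸ Submodule.subset_span (by simp)
  obtain ⟨t, ht⟩ := mem_lineSpan.mp hmem
  have ht0 : t = 0 := by simpa [-Fin.succ_mk] using congrFun ht (Fin.succ ⟨0, hk0⟩)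
  funext j
  by_cases hj : (j : ℕ) = 0
  · obtain rfl : j = ⟨0, hk0⟩ := Fin.ext hj
    simpa [ext_of_lt _ hk0] using h0
  · simpa [ht0, hj] using (congrFun ht j.succ).symm

lemma exists_lineSpan_eq (hk : 0 < k) (l : ArcLine k F) : ∃ b : Fin k → F, lineSpan b = l.1 := by
  obtain ⟨l, hl, x, hx⟩ := l
  have hn : nrc k F x ∈ l ⊓ Sigma0 k F := hx ▸ Submodule.mem_span_singleton_self _
  obtain ⟨v, hv, hv0⟩ : ∃ v ∈ l, v 0 ≠ 0 := by
    by_contra! hcon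
    have hle : l ≤ Sigma0 k F := fun v hv => mem_Sigma0.mpr (hcon v hv)
    rw [inf_eq_left.mpr hle] at hx
    rw [hx, finrank_span_singleton (nrc_ne_zero hk x)] at hl
    omega
  let w : Fin (k + 1) → F := (v 0)⁻¹ • (v - v (Fin.succ ⟨0, hk⟩) • nrc k F x)
  have hw : w ∈ l := l.smul_mem _ (l.sub_mem hv (l.smul_mem _ hn.1))
  have hw0 : w 0 = 1 := by simp [w, hv0]
  have hw1 : w (Fin.succ ⟨0, hk⟩) = 0 := by simp [w, -Fin.succ_mk]
  let b : Fin k → F := fun j => if (j : ℕ) = 0 then x else -w j.succ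
  have hb : ext b 0 = x := by simp [ext_of_lt b hk, b]
  have hbw : baseVec b = w := by
    funext i
    refine Fin.cases (by simp [hw0]) (fun j => ?_) i
    by_cases hj : (j : ℕ) = 0
    · obtain rfl : j = ⟨0, hk⟩ := Fin.ext hj
      simpa [-Fin.succ_mk] using hw1.symm
    · simp [b, hj]
  refine ⟨b, le_antisymm ?_ fun u hu => ?_⟩
  · rw [lineSpan, hb, hbw, Submodule.span_le]
    rintro _ (rfl | rfl)
    exacts [hw, hn.1]
  · have hmem : u - u 0 • w ∈ Submodule.span F {nrc k F x} := by
      rw [← hx]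
      exact ⟨l.sub_mem hu (l.smul_mem _ hw), mem_Sigma0.mpr (by simp [hw0])⟩
    obtain ⟨t, ht⟩ := Submodule.mem_span_singleton.mp hmem
    exact mem_lineSpan.mpr ⟨t, by rw [hb, hbw, ht]; abel⟩

/-- The point `[1 : a₁ : ⋯ : a_k]`. -/
def toArcPoint (a : Fin k → F) : ArcPoint k F :=
  ⟨Submodule.span F {affineVec a}, finrank_span_singleton fun h => by
    simpa using congrFun h 0, fun h => by
    simpa [mem_Sigma0] using h (Submodule.mem_span_singleton_self _)⟩

/-- The line `lineSpan b`, as a vertex of `GArc k F`. -/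
def toArcLine (hk : 0 < k) (b : Fin k → F) : ArcLine k F :=
  ⟨lineSpan b, finrank_lineSpan hk b, ext b 0, lineSpan_inf_Sigma0 b⟩

lemma toArcPoint_bijective :
    Function.Bijective (toArcPoint : (Fin k → F) → ArcPoint k F) := by
  constructor
  · intro a a' h
    have hmem : affineVec a ∈ Submodule.span F {affineVec a'} := by
      have hspan : Submodule.span F {affineVec a} = Submodule.span F {affineVec a'} :=
        congrArg Subtype.val h
      exact hspan ▸ Submodule.mem_span_singleton_self _
    obtain ⟨t, ht⟩ := Submodule.mem_span_singleton.mp hmem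
    have ht1 : t = 1 := by simpa using congrFun ht 0
    funext j
    simpa [ht1] using (congrFun ht j.succ).symm
  · rintro ⟨p, hp, hp0⟩
    obtain ⟨v, hv, hv0⟩ := SetLike.not_le_iff_exists.mp hp0
    rw [mem_Sigma0] at hv0
    refine ⟨fun j => (v 0)⁻¹ * v j.succ, Subtype.ext ?_⟩
    have hvec : affineVec (fun j => (v 0)⁻¹ * v j.succ) = (v 0)⁻¹ • v := by
      funext i
      exact Fin.cases (by simp [hv0]) (fun j => by simp) i
    refine Submodule.eq_of_le_of_finrank_eq ?_ ?_
    · refine (Submodule.span_singleton_le_iff_mem _ _).mpr ?_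
      rw [hvec]
      exact p.smul_mem _ hv
    · exact (toArcPoint _).2.1.trans hp.symm

lemma toArcLine_bijective (hk : 2 ≤ k) :
    Function.Bijective (toArcLine (F := F) (by omega : 0 < k)) :=
  ⟨fun _ _ h => lineSpan_injective hk (congrArg Subtype.val h), fun l =>
    (exists_lineSpan_eq (by omega) l).imp fun _ => Subtype.ext⟩

lemma toArcPoint_le_toArcLine (hk : 0 < k) (a b : Fin k → F) :
    (toArcPoint a).1 ≤ (toArcLine hk b).1 ↔ Wrel k F a b := by
  rw [← affineVec_mem_lineSpan hk]
  exact Submodule.span_singleton_le_iff_mem _ _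

end Coordinates

/-- For `k ≥ 2` and any prime power `q`, the incidence graph
`G_arc(k, q, α₀⁻)` is isomorphic to Wenger's graph `H(k,q)`. -/
theorem GArc_iso_Wenger (k : ℕ) (hk : 2 ≤ k) (F : Type) [Field F] [Fintype F] :
    Nonempty (GArc k F ≃g WGraph k F) := by
  have hk0 : 0 < k := by omega
  let e := Equiv.sumCongr (Equiv.ofBijective _ (toArcPoint_bijective (k := k) (F := F)))
    (Equiv.ofBijective _ (toArcLine_bijective (F := F) hk))
  refine ⟨RelIso.symm ⟨e, ?_⟩⟩
  rintro (a | b) (a' | b') <;>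
    simp [e, GArc, WGraph, SimpleGraph.fromRel_adj, toArcPoint_le_toArcLine]

end Paper
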